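/- Let (Ω, F, P) be a non-atomic probability space and let A ∈ F be a measurable set with P(A) = n/m for natural numbers 1 ≤ n ≤ m. Then, in L^∞(P), the element 1_A − (n/m)·1 belongs to the linear span (over ℝ) of { U − V : U, V ∈ L^∞(P), U ~ V }. -/

import Mathlib

open MeasureTheory ProbabilityTheory
open scoped ENNReal

/-- A measure is nonatomic if every measurable set of positive measure admits a measurable
subset of strictly smaller positive measure. -/
def Nonatomic {Ω : Type*} [MeasurableSpace Ω] (μ : Measure Ω) : Prop :=
  ∀ s : Set Ω, MeasurableSet s → 0 < μ s →
    ∃ t, t ⊆ s ∧ MeasurableSet t ∧ 0 < μ t ∧ μ t < μ s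

lemma Nonatomic.exists_measureReal_le_half {Ω : Type*} [MeasurableSpace Ω] {μ : Measure Ω}
    [IsFiniteMeasure μ] (hμ : Nonatomic μ) {s : Set Ω} (hs : MeasurableSet s)
    (h0 : 0 < μ.real s) :
    ∃ t ⊆ s, MeasurableSet t ∧ 0 < μ.real t ∧ μ.real t ≤ μ.real s / 2 := by
  obtain ⟨t, hts, ht, ht0, hlt⟩ := hμ s hs (ENNReal.toReal_pos_iff.1 h0).1
  have ht0' : 0 < μ.real t := ENNReal.toReal_pos_iff.2 ⟨ht0, measure_lt_top μ t⟩
  have hlt' : μ.real t < μ.real s :=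
    (ENNReal.toReal_lt_toReal (measure_ne_top μ t) (measure_ne_top μ s)).2 hlt
  have hd : μ.real (s \ t) = μ.real s - μ.real t := measureReal_sdiff hts ht
  rcases le_total (μ.real t) (μ.real s / 2) with h | h
  · exact ⟨t, hts, ht, ht0', h⟩
  · exact ⟨s \ t, Set.sdiff_subset, hs.diff ht, by linarith, by linarith⟩

lemma Nonatomic.exists_measureReal_lt {Ω : Type*} [MeasurableSpace Ω] {μ : Measure Ω}
    [IsFiniteMeasure μ] (hμ : Nonatomic μ) {s : Set Ω} (hs : MeasurableSet s)
    (h0 : 0 < μ.real s) {ε : ℝ} (hε : 0 < ε) :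
    ∃ t ⊆ s, MeasurableSet t ∧ 0 < μ.real t ∧ μ.real t < ε := by
  have key : ∀ k : ℕ, ∃ t ⊆ s, MeasurableSet t ∧ 0 < μ.real t ∧
      μ.real t ≤ μ.real s * (1 / 2) ^ k := by
    intro k
    induction k with
    | zero => exact ⟨s, subset_rfl, hs, h0, by simp⟩
    | succ k ih =>
      obtain ⟨t, hts, ht, ht0, hle⟩ := ih
      obtain ⟨u, hut, hu, hu0, hule⟩ := hμ.exists_measureReal_le_half ht ht0
      exact ⟨u, hut.trans hts, hu, hu0, by rw [pow_succ]; linarith⟩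
  obtain ⟨k, hk⟩ := exists_pow_lt_of_lt_one (div_pos hε h0) (by norm_num : (1 / 2 : ℝ) < 1)
  obtain ⟨t, hts, ht, ht0, hle⟩ := key k
  refine ⟨t, hts, ht, ht0, hle.trans_lt ?_⟩
  rwa [lt_div_iff₀' h0] at hk

/-- Sierpiński's theorem: a finite nonatomic measure takes all intermediate values. -/
theorem Nonatomic.exists_subset_measureReal_eq {Ω : Type*} [MeasurableSpace Ω] {μ : Measure Ω}
    [IsFiniteMeasure μ] (hμ : Nonatomic μ) {s : Set Ω} (hs : MeasurableSet s)
    {c : ℝ} (hc : 0 ≤ c) (hcs : c ≤ μ.real s) :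
    ∃ t ⊆ s, MeasurableSet t ∧ μ.real t = c := by
  let good : Set Ω → Prop := fun u => u ⊆ s ∧ MeasurableSet u ∧ μ.real u ≤ c
  have step : ∀ u, good u → ∃ u', good u' ∧ u ⊆ u' ∧
      ∀ w, good w → u ⊆ w → μ.real u + μ.real w ≤ 2 * μ.real u' := by
    intro u hu
    let S : Set ℝ := {x | ∃ w, good w ∧ u ⊆ w ∧ μ.real w = x}
    have hbdd : BddAbove S := ⟨c, by rintro x ⟨w, hw, -, rfl⟩; exact hw.2.2⟩
    have huS : μ.real u ∈ S := ⟨u, hu, subset_rfl, rfl⟩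
    have hle : ∀ w, good w → u ⊆ w → μ.real w ≤ sSup S := fun w hw huw =>
      le_csSup hbdd ⟨w, hw, huw, rfl⟩
    rcases (hle u hu subset_rfl).eq_or_lt with h | h
    · exact ⟨u, hu, subset_rfl, fun w hw huw => by linarith [hle w hw huw]⟩
    · obtain ⟨x, ⟨w, hw, huw, rfl⟩, hx⟩ :=
        exists_lt_of_lt_csSup ⟨_, huS⟩ (show (μ.real u + sSup S) / 2 < sSup S by linarith)
      exact ⟨w, hw, huw, fun v hv huv => by linarith [hle v hv huv]⟩
  choose! next hgood hsub hmax using step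
  let t : ℕ → Set Ω := fun k => next^[k] ∅
  have ht_succ : ∀ k, t (k + 1) = next (t k) := fun k => Function.iterate_succ_apply' _ _ _
  have ht : ∀ k, good (t k) := by
    intro k
    induction k with
    | zero => exact ⟨Set.empty_subset _, MeasurableSet.empty, by simpa [t] using hc⟩
    | succ k ih => rw [ht_succ]; exact hgood _ ih
  have hmono : Monotone t := monotone_nat_of_le_succ fun k => by
    rw [ht_succ]; exact hsub _ (ht k)
  have hTm : MeasurableSet (⋃ k, t k) := .iUnion fun k => (ht k).2.1
  have hTs : (⋃ k, t k) ⊆ s := Set.iUnion_subset fun k => (ht k).1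
  have hlim : Filter.Tendsto (fun k => μ.real (t k)) Filter.atTop (nhds (μ.real (⋃ k, t k))) :=
    (ENNReal.tendsto_toReal (measure_ne_top μ _)).comp (tendsto_measure_iUnion_atTop hmono)
  have hTc : μ.real (⋃ k, t k) ≤ c := le_of_tendsto' hlim fun k => (ht k).2.2
  refine ⟨_, hTs, hTm, hTc.antisymm (not_lt.1 fun hlt => ?_)⟩
  have hd : μ.real (s \ ⋃ k, t k) = μ.real s - μ.real (⋃ k, t k) := measureReal_sdiff hTs hTm
  obtain ⟨v, hvs, hv, hv0, hvlt⟩ := hμ.exists_measureReal_lt (hs.diff hTm)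
    (by linarith) (sub_pos.2 hlt)
  have hdisj : Disjoint (⋃ k, t k) v := (Set.disjoint_sdiff_left.mono_left hvs).symm
  have hU : μ.real ((⋃ k, t k) ∪ v) = μ.real (⋃ k, t k) + μ.real v :=
    measureReal_union hdisj hv
  have hgU : good ((⋃ k, t k) ∪ v) :=
    ⟨Set.union_subset hTs (hvs.trans Set.sdiff_subset), hTm.union hv, by linarith⟩
  have hineq : ∀ k, μ.real (t k) + μ.real ((⋃ k, t k) ∪ v) ≤ 2 * μ.real (t (k + 1)) := fun k => by
    rw [ht_succ]
    exact hmax _ (ht k) _ hgU ((Set.subset_iUnion t k).trans Set.subset_union_left)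
  have := le_of_tendsto_of_tendsto' (hlim.add_const _)
    (((Filter.tendsto_add_atTop_iff_nat 1).2 hlim).const_mul 2) hineq
  linarith

lemma identDistrib_indicatorConstLp {Ω : Type*} [MeasurableSpace Ω] {μ : Measure Ω}
    [IsFiniteMeasure μ] {s t : Set Ω} (hs : MeasurableSet s) (ht : MeasurableSet t)
    (h : μ s = μ t) (p : ℝ≥0∞) (x : ℝ) :
    IdentDistrib (indicatorConstLp p hs (measure_ne_top μ s) x : Ω → ℝ)
      (indicatorConstLp p ht (measure_ne_top μ t) x : Ω → ℝ) μ μ := by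
  have hm : ∀ {u : Set Ω}, MeasurableSet u → Measurable (u.indicator fun _ => x) :=
    fun hu => measurable_const.indicator hu
  have hind : IdentDistrib (s.indicator fun _ => x) (t.indicator fun _ => x) μ μ := by
    refine ⟨(hm hs).aemeasurable, (hm ht).aemeasurable, Measure.ext fun B hB => ?_⟩
    rw [Measure.map_apply (hm hs) hB, Measure.map_apply (hm ht) hB]
    classical
    have hcompl : μ sᶜ = μ tᶜ := by
      rw [measure_compl hs (measure_ne_top μ s), measure_compl ht (measure_ne_top μ t), h]
    rw [Set.indicator_const_preimage_eq_union, Set.indicator_const_preimage_eq_union]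
    split_ifs <;> simp [h, hcompl]
  have hs' := IdentDistrib.of_ae_eq (Lp.stronglyMeasurable _).aestronglyMeasurable.aemeasurable
    (indicatorConstLp_coeFn (p := p) (hs := hs) (hμs := measure_ne_top μ s) (c := x))
  have ht' := IdentDistrib.of_ae_eq (Lp.stronglyMeasurable _).aestronglyMeasurable.aemeasurable
    (indicatorConstLp_coeFn (p := p) (hs := ht) (hμs := measure_ne_top μ t) (c := x))
  exact hs'.trans (hind.trans ht'.symm)

/-- In a nonatomic space, modulo differences of identically distributed elements, the indicator
of a set whose measure is `k` times that of `C` is `k` times the indicator of `C`. -/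
lemma Nonatomic.indicatorConstLp_sub_smul_mem_span {Ω : Type*} [MeasurableSpace Ω]
    {μ : Measure Ω} [IsFiniteMeasure μ] (hμ : Nonatomic μ) {C : Set Ω} (hC : MeasurableSet C)
    (k : ℕ) {B : Set Ω} (hB : MeasurableSet B) (hBC : μ.real B = k * μ.real C) :
    indicatorConstLp ⊤ hB (measure_ne_top μ B) (1 : ℝ)
        - (k : ℝ) • indicatorConstLp ⊤ hC (measure_ne_top μ C) (1 : ℝ) ∈
      Submodule.span ℝ {W : Lp ℝ ⊤ μ |
        ∃ U V : Lp ℝ ⊤ μ, IdentDistrib (U : Ω → ℝ) (V : Ω → ℝ) μ μ ∧ W = U - V} := by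
  induction k generalizing B with
  | zero =>
    refine Submodule.subset_span ⟨_, _, identDistrib_indicatorConstLp hB .empty ?_ ⊤ 1, ?_⟩
    · simpa [measureReal_eq_zero_iff] using hBC
    · simp
  | succ k ih =>
    push_cast at hBC
    have h0 : 0 ≤ (k : ℝ) * μ.real C := by positivity
    obtain ⟨D, hDB, hD, hDC⟩ := hμ.exists_subset_measureReal_eq hB
      (measureReal_nonneg (μ := μ) (s := C)) (by linarith)
    have hd : μ.real (B \ D) = μ.real B - μ.real D := measureReal_sdiff hDB hD
    have h1 := ih (hB.diff hD) (by rw [hd, hBC, hDC]; ring)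
    have h2 : indicatorConstLp ⊤ hD (measure_ne_top μ D) (1 : ℝ)
        - indicatorConstLp ⊤ hC (measure_ne_top μ C) (1 : ℝ) ∈
        Submodule.span ℝ {W : Lp ℝ ⊤ μ |
          ∃ U V : Lp ℝ ⊤ μ, IdentDistrib (U : Ω → ℝ) (V : Ω → ℝ) μ μ ∧ W = U - V} :=
      Submodule.subset_span ⟨_, _, identDistrib_indicatorConstLp hD hC
        ((measureReal_eq_measureReal_iff).1 hDC) ⊤ 1, rfl⟩
    have hsplit : indicatorConstLp ⊤ hB (measure_ne_top μ B) (1 : ℝ) =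
        indicatorConstLp ⊤ hD (measure_ne_top μ D) (1 : ℝ) +
        indicatorConstLp ⊤ (hB.diff hD) (measure_ne_top μ _) (1 : ℝ) := by
      rw [← indicatorConstLp_disjoint_union hD (hB.diff hD) _ _ Set.disjoint_sdiff_right]
      congr 1
      exact (Set.union_sdiff_cancel hDB).symm
    convert add_mem h1 h2 using 1
    rw [hsplit]
    push_cast
    module

/-- If `P(A) = n/m` with `1 ≤ n ≤ m`, then `1_A - (n/m)·1` lies in the span of differences
of identically distributed elements of `L^∞`. -/
theorem indicator_sub_const_mem_span
    {Ω : Type*} [MeasurableSpace Ω] (P : Measure Ω) [IsProbabilityMeasure P]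
    (hP : Nonatomic P) (n m : ℕ) (hn : 1 ≤ n) (hnm : n ≤ m)
    (A : Set Ω) (hA : MeasurableSet A) (hPA : P A = (n : ℝ≥0∞) / (m : ℝ≥0∞)) :
    indicatorConstLp ⊤ hA (measure_ne_top P A) (1 : ℝ)
        - ((n : ℝ) / (m : ℝ)) • Lp.const ⊤ P (1 : ℝ) ∈
      Submodule.span ℝ {W : Lp ℝ ⊤ P |
        ∃ U V : Lp ℝ ⊤ P, IdentDistrib (U : Ω → ℝ) (V : Ω → ℝ) P P ∧ W = U - V} := by
  have hm : (m : ℝ) ≠ 0 := by exact_mod_cast (by omega : m ≠ 0)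
  have hA' : P.real A = n / m := by simp [Measure.real, hPA]
  obtain ⟨C, -, hC, hCm⟩ := hP.exists_subset_measureReal_eq MeasurableSet.univ
    (c := 1 / (m : ℝ)) (by positivity) (by
      rw [probReal_univ, div_le_one (by positivity)]
      exact_mod_cast hn.trans hnm)
  have h1 := hP.indicatorConstLp_sub_smul_mem_span hC n hA (by rw [hA', hCm]; ring)
  have h2 := hP.indicatorConstLp_sub_smul_mem_span hC m MeasurableSet.univ
    (by rw [probReal_univ, hCm]; field_simp)
  rw [indicatorConstLp_univ] at h2
  convert sub_mem h1 (Submodule.smul_mem _ ((n : ℝ) / m) h2) using 1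
  rw [smul_sub, smul_smul, div_mul_cancel₀ _ hm]
  abel
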